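/- Let p ∈ (2,∞) and β ∈ (0,1). Let f(x) = (−1)^{⌊−log₂ x⌋} |x|^{−β/(p−1)} 1_{(0,1)}(x), σ(x) = |x|^{β/(p−1)}, w(x) = |x|^{−β} for x ≠ 0 (f(0)=σ(0)=w(0)=1). Then ‖S(σf)‖_{L^p(w)} ≥ c_p (1−β)^{−1/2−1/p}, where c_p > 0 depends only on p and S is the dyadic square function on ℝ. -/

import Mathlib

open MeasureTheory Set Filter
open scoped ENNReal NNReal

noncomputable section

/-- Average of `g` over the interval `[a, b)` (with respect to Lebesgue measure). -/
def avgI (g : ℝ → ℝ) (a b : ℝ) : ℝ := (b - a)⁻¹ * ∫ x in Set.Ico a b, g x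

/-- The dyadic interval `[k·2^{-n}, (k+1)·2^{-n})`. -/
def dyadicI (n k : ℤ) : Set ℝ :=
  Set.Ico ((k : ℝ) * (2:ℝ) ^ (-n)) (((k : ℝ) + 1) * (2:ℝ) ^ (-n))

/-- Average of `g` over the dyadic interval `dyadicI n k`. -/
def avgD (g : ℝ → ℝ) (n k : ℤ) : ℝ :=
  avgI g ((k : ℝ) * (2:ℝ) ^ (-n)) (((k : ℝ) + 1) * (2:ℝ) ^ (-n))

/-- The martingale difference `Δ_Q g` associated with the dyadic interval `Q = dyadicI n k`:
`Δ_Q g = Σ_{R child of Q} ⟨g⟩_R 1_R − ⟨g⟩_Q 1_Q`. -/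
def deltaD (g : ℝ → ℝ) (n k : ℤ) (x : ℝ) : ℝ :=
  (dyadicI (n+1) (2*k)).indicator (fun _ => avgD g (n+1) (2*k)) x
    + (dyadicI (n+1) (2*k+1)).indicator (fun _ => avgD g (n+1) (2*k+1)) x
    - (dyadicI n k).indicator (fun _ => avgD g n k) x

/-- The dyadic square function on `ℝ`. -/
def sqFn (g : ℝ → ℝ) (x : ℝ) : ℝ :=
  Real.sqrt (∑' q : ℤ × ℤ, (deltaD g q.1 q.2 x) ^ 2)

open Classical in
/-- The dyadic square function over `[0,1)`: the sum runs only over dyadic intervals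
contained in `[0,1)`. -/
def sqFn01 (g : ℝ → ℝ) (x : ℝ) : ℝ :=
  Real.sqrt (∑' q : ℤ × ℤ,
    if dyadicI q.1 q.2 ⊆ Set.Ico (0:ℝ) 1 then (deltaD g q.1 q.2 x) ^ 2 else 0)

/-- `‖g‖_{L^p(w)}` (as an extended nonnegative real), `w dx` being the underlying measure. -/
def pNorm (p : ℝ) (g w : ℝ → ℝ) : ℝ≥0∞ :=
  (∫⁻ x : ℝ, ENNReal.ofReal (|g x| ^ p * w x)) ^ (1/p)

/-- `‖g‖_{L^p(w)}` over `[0,1)`. -/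
def pNorm01 (p : ℝ) (g w : ℝ → ℝ) : ℝ≥0∞ :=
  (∫⁻ x in Set.Ico (0:ℝ) 1, ENNReal.ofReal (|g x| ^ p * w x)) ^ (1/p)

/-- The joint `A_p` characteristic `[w,σ]_{A_p}`, the supremum running over all bounded
intervals of `ℝ`. -/
def apChar (p : ℝ) (w σ : ℝ → ℝ) : ℝ≥0∞ :=
  ⨆ (a : ℝ) (b : ℝ) (_ : a < b),
    ENNReal.ofReal (avgI w a b * (avgI σ a b) ^ (p - 1))

/-- The joint `A_p` characteristic `[w,σ]_{A_p}`, the supremum running over all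
subintervals of `[0,1)`. -/
def apChar01 (p : ℝ) (w σ : ℝ → ℝ) : ℝ≥0∞ :=
  ⨆ (a : ℝ) (b : ℝ) (_ : 0 ≤ a) (_ : a < b) (_ : b ≤ 1),
    ENNReal.ofReal (avgI w a b * (avgI σ a b) ^ (p - 1))

/-- The local maximal function `M_{[a,b)} σ (x) = sup { ⟨σ⟩_R : R interval ⊆ [a,b), x ∈ R }`. -/
def maxFn (σ : ℝ → ℝ) (a b x : ℝ) : ℝ≥0∞ :=
  ⨆ (c : ℝ) (e : ℝ) (_ : a ≤ c) (_ : c < e) (_ : e ≤ b) (_ : x ∈ Set.Ico c e),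
    ENNReal.ofReal (avgI σ c e)

/-- The Fujii–Wilson `A_∞` characteristic
`[σ]_{A_∞} = sup_Q (1/σ(Q)) ∫_Q M_Q σ`, the supremum over bounded intervals of `ℝ`. -/
def ainfChar (σ : ℝ → ℝ) : ℝ≥0∞ :=
  ⨆ (a : ℝ) (b : ℝ) (_ : a < b),
    (∫⁻ x in Set.Ico a b, maxFn σ a b x) / ENNReal.ofReal (∫ x in Set.Ico a b, σ x)

/-- A weight on `ℝ`: measurable, a.e. positive, integrable over every bounded interval. -/
def IsWeight (w : ℝ → ℝ) : Prop :=
  Measurable w ∧ (∀ᵐ x : ℝ, 0 < w x) ∧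
    ∀ a b : ℝ, a < b → IntegrableOn w (Set.Ico a b)

/-- A weight on `[0,1)`: measurable, a.e. positive on `[0,1)`, integrable over `[0,1)`. -/
def IsWeight01 (w : ℝ → ℝ) : Prop :=
  Measurable w ∧ (∀ᵐ x : ℝ, x ∈ Set.Ico (0:ℝ) 1 → 0 < w x) ∧
    IntegrableOn w (Set.Ico (0:ℝ) 1)


/-- Up to endpoints of dyadic intervals, `G` is the alternating sign function
`(-1)^m` on `(2^{-(m+1)}, 2^{-m})`, supported in `[0,1)`. -/
structure IsAlternatingSign (G : ℝ → ℝ) : Prop where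
  measurable : Measurable G
  abs_le_indicator : ∀ x, |G x| ≤ (Set.Ico (0:ℝ) 1).indicator (fun _ => (1:ℝ)) x
  eq_sign : ∀ m : ℤ, 0 ≤ m → ∀ x ∈ Set.Ioo ((2:ℝ) ^ (-(m+1))) ((2:ℝ) ^ (-m)), G x = (-1) ^ m

theorem mem_dyadicI_iff (n k : ℤ) (x : ℝ) : x ∈ dyadicI n k ↔ ⌊x * (2:ℝ) ^ n⌋ = k := by
  have h2 : (0:ℝ) < 2 ^ n := by positivity
  rw [Int.floor_eq_iff, dyadicI, Set.mem_Ico, zpow_neg, ← div_eq_mul_inv, ← div_eq_mul_inv,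
    div_le_iff₀ h2, lt_div_iff₀ h2]

theorem dyadicI_left_child_subset (n k : ℤ) : dyadicI (n+1) (2*k) ⊆ dyadicI n k := by
  have h2 : (0:ℝ) < 2 ^ (-n) := by positivity
  have h : (2:ℝ) ^ (-(n+1)) = 2 ^ (-n) / 2 := by
    rw [neg_add, zpow_add₀ two_ne_zero]; norm_num; ring
  apply Set.Ico_subset_Ico <;> rw [h] <;> push_cast <;> nlinarith

theorem dyadicI_right_child_subset (n k : ℤ) : dyadicI (n+1) (2*k+1) ⊆ dyadicI n k := by
  have h2 : (0:ℝ) < 2 ^ (-n) := by positivity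
  have h : (2:ℝ) ^ (-(n+1)) = 2 ^ (-n) / 2 := by
    rw [neg_add, zpow_add₀ two_ne_zero]; norm_num; ring
  apply Set.Ico_subset_Ico <;> rw [h] <;> push_cast <;> nlinarith

theorem mem_child_of_mem_dyadicI {n k : ℤ} {x : ℝ} (hx : x ∈ dyadicI n k) :
    (x ∈ dyadicI (n+1) (2*k) ∧ x ∉ dyadicI (n+1) (2*k+1)) ∨
      (x ∉ dyadicI (n+1) (2*k) ∧ x ∈ dyadicI (n+1) (2*k+1)) := by
  rw [mem_dyadicI_iff, Int.floor_eq_iff] at hx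
  have h : x * (2:ℝ) ^ (n+1) = 2 * (x * 2 ^ n) := by
    rw [zpow_add₀ two_ne_zero]; norm_num; ring
  simp only [mem_dyadicI_iff, h]
  have h1 : 2 * k ≤ ⌊2 * (x * (2:ℝ) ^ n)⌋ := by
    rw [Int.le_floor]; push_cast; linarith
  have h3 : ⌊2 * (x * (2:ℝ) ^ n)⌋ < 2 * k + 2 := by
    rw [Int.floor_lt]; push_cast; linarith
  omega

theorem deltaD_eq_zero_of_notMem (g : ℝ → ℝ) {n k : ℤ} {x : ℝ} (hx : x ∉ dyadicI n k) :
    deltaD g n k x = 0 := by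
  have h1 : x ∉ dyadicI (n+1) (2*k) := fun h => hx (dyadicI_left_child_subset n k h)
  have h2 : x ∉ dyadicI (n+1) (2*k+1) := fun h => hx (dyadicI_right_child_subset n k h)
  simp [deltaD, hx, h1, h2]

namespace IsAlternatingSign

variable {G : ℝ → ℝ}

theorem integrable (hG : IsAlternatingSign G) : Integrable G := by
  have h : Integrable ((Set.Ico (0:ℝ) 1).indicator (fun _ => (1:ℝ))) :=
    (integrableOn_const (by simp)).integrable_indicator measurableSet_Ico
  exact h.mono' hG.measurable.aestronglyMeasurable (Eventually.of_forall hG.abs_le_indicator)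

theorem abs_avgD_le (hG : IsAlternatingSign G) (n k : ℤ) : |avgD G n k| ≤ 2 ^ n := by
  have h1 : |∫ x in dyadicI n k, G x| ≤ 1 := by
    calc |∫ x in dyadicI n k, G x| ≤ ∫ x in dyadicI n k, |G x| := abs_integral_le_integral_abs
      _ ≤ ∫ x, |G x| := setIntegral_le_integral hG.integrable.abs
            (Eventually.of_forall fun x => abs_nonneg _)
      _ ≤ ∫ x, (Set.Ico (0:ℝ) 1).indicator (fun _ => (1:ℝ)) x :=
            integral_mono hG.integrable.abs
              ((integrableOn_const (by simp)).integrable_indicator measurableSet_Ico)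
              hG.abs_le_indicator
      _ = 1 := by simp [integral_indicator measurableSet_Ico]
  have h2 : ((k + 1) * (2:ℝ) ^ (-n) - k * (2:ℝ) ^ (-n))⁻¹ = 2 ^ n := by
    rw [← sub_mul, add_sub_cancel_left, one_mul, zpow_neg, inv_inv]
  have h3 : (0:ℝ) < 2 ^ n := by positivity
  rw [avgD, avgI, h2, abs_mul, abs_of_pos h3]
  exact mul_le_of_le_one_right h3.le h1

theorem setIntegral_eq (hG : IsAlternatingSign G) {m : ℤ} (hm : 0 ≤ m) {a b : ℝ} (hab : a ≤ b)
    (ha : (2:ℝ) ^ (-(m+1)) ≤ a) (hb : b ≤ 2 ^ (-m)) :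
    ∫ x in Set.Ico a b, G x = (b - a) * (-1) ^ m := by
  rw [integral_Ico_eq_integral_Ioo,
    setIntegral_congr_fun (g := fun _ => (-1:ℝ) ^ m) measurableSet_Ioo
      (fun x hx => hG.eq_sign m hm x ⟨ha.trans_lt hx.1, hx.2.trans_le hb⟩)]
  simp [hab]

theorem avgD_eq (hG : IsAlternatingSign G) {m : ℤ} (hm : 0 ≤ m) {n k : ℤ}
    (h : dyadicI n k ⊆ dyadicI (m+1) 1) : avgD G n k = (-1) ^ m := by
  have h2 : (0:ℝ) < 2 ^ (-n) := by positivity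
  have hlt : (k:ℝ) * 2 ^ (-n) < (k + 1) * 2 ^ (-n) := by nlinarith
  have hm2 : (2:ℝ) ^ (-m) = (1 + 1) * 2 ^ (-(m+1)) := by
    rw [neg_add, zpow_add₀ two_ne_zero]; norm_num; ring
  obtain ⟨ha, hb⟩ := (Set.Ico_subset_Ico_iff hlt).1 h
  rw [avgD, avgI, hG.setIntegral_eq hm hlt.le (by simpa using ha) (by rw [hm2]; simpa using hb),
    ← mul_assoc, inv_mul_cancel₀ (sub_pos.2 hlt).ne', one_mul]

theorem abs_avgD_le_one (hG : IsAlternatingSign G) (n k : ℤ) : |avgD G n k| ≤ 1 := by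
  have h2 : (0:ℝ) < 2 ^ (-n) := by positivity
  have hlt : 0 < (k + 1) * (2:ℝ) ^ (-n) - k * (2:ℝ) ^ (-n) := by nlinarith
  have hG1 : ∀ x, ‖G x‖ ≤ 1 := fun x => (hG.abs_le_indicator x).trans
    (Set.indicator_le_self' (fun _ _ => zero_le_one) x)
  have h := norm_setIntegral_le_of_norm_le_const (μ := volume) (f := G) (C := 1)
    (s := Set.Ico ((k:ℝ) * (2:ℝ) ^ (-n)) ((k + 1) * (2:ℝ) ^ (-n))) (by simp) (fun x _ => hG1 x)
  rw [Real.volume_real_Ico_of_le (sub_pos.1 hlt).le, one_mul, Real.norm_eq_abs] at h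
  rw [avgD, avgI, abs_mul, abs_of_pos (inv_pos.2 hlt), inv_mul_le_iff₀ hlt, mul_one]
  exact h

theorem abs_deltaD_le (hG : IsAlternatingSign G) (n k : ℤ) (x : ℝ) :
    |deltaD G n k x| ≤ 3 * 2 ^ n := by
  by_cases hx : x ∈ dyadicI n k
  · have h0 := hG.abs_avgD_le n k
    have h1 := hG.abs_avgD_le (n+1) (2*k)
    have h2 := hG.abs_avgD_le (n+1) (2*k+1)
    rw [zpow_add₀ two_ne_zero, zpow_one] at h1 h2
    rw [abs_le] at h0 h1 h2 ⊢
    rcases mem_child_of_mem_dyadicI hx with ⟨ha, hb⟩ | ⟨ha, hb⟩ <;>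
      simp only [deltaD, hx, ha, hb, Set.indicator_of_mem, Set.indicator_of_notMem,
        not_false_eq_true] <;>
      constructor <;> linarith
  · rw [deltaD_eq_zero_of_notMem G hx, abs_zero]
    positivity

theorem deltaD_eq_zero (hG : IsAlternatingSign G) {m : ℤ} (hm : 0 ≤ m) {n k : ℤ}
    (h : dyadicI n k ⊆ dyadicI (m+1) 1) (x : ℝ) : deltaD G n k x = 0 := by
  by_cases hx : x ∈ dyadicI n k
  · have h0 := hG.avgD_eq hm h
    have h1 := hG.avgD_eq hm ((dyadicI_left_child_subset n k).trans h)
    have h2 := hG.avgD_eq hm ((dyadicI_right_child_subset n k).trans h)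
    rcases mem_child_of_mem_dyadicI hx with ⟨ha, hb⟩ | ⟨ha, hb⟩ <;>
      simp [deltaD, hx, ha, hb, h0, h1, h2]
  · exact deltaD_eq_zero_of_notMem G hx

end IsAlternatingSign

/-- Dyadic intervals are nested: a finer one meeting a coarser one is contained in it. -/
theorem dyadicI_subset_of_mem {n k m j : ℤ} (hmn : m ≤ n) {x : ℝ} (hn : x ∈ dyadicI n k)
    (hm : x ∈ dyadicI m j) : dyadicI n k ⊆ dyadicI m j := by
  obtain ⟨d, rfl⟩ := Int.le.dest hmn
  rw [mem_dyadicI_iff] at hn hm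
  intro y hy
  rw [mem_dyadicI_iff] at hy ⊢
  have key : ∀ z : ℝ, ⌊z * (2:ℝ) ^ m⌋ = ⌊z * (2:ℝ) ^ (m + (d:ℤ))⌋ / (2 ^ d : ℕ) := by
    intro z
    rw [← Int.floor_div_natCast, zpow_add₀ two_ne_zero, zpow_natCast]
    congr 1
    push_cast
    field_simp
  rw [key, hy, ← hn, ← key, hm]

theorem IsAlternatingSign.summable_sq_deltaD {G : ℝ → ℝ} (hG : IsAlternatingSign G) {x : ℝ}
    (hx : x ∈ Set.Ioo (0:ℝ) 1) : Summable fun q : ℤ × ℤ => (deltaD G q.1 q.2 x) ^ 2 := by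
  obtain ⟨l, hl1, hl2⟩ := exists_mem_Ico_zpow hx.1 (one_lt_two (α := ℝ))
  have hl : l < 0 := by
    by_contra! h
    exact absurd (hl1.trans_lt hx.2) (not_lt.2 (one_le_zpow₀ one_le_two h))
  have hxm : x ∈ dyadicI ((-l - 1) + 1) 1 := by
    refine ⟨by simpa using hl1, ?_⟩
    rw [zpow_add₀ two_ne_zero] at hl2
    norm_num
    linarith
  have hinj : Function.Injective fun n : ℤ => (n, ⌊x * (2:ℝ) ^ n⌋) :=
    fun a b h => (Prod.ext_iff.1 h).1
  rw [← hinj.summable_iff]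
  · have hzero : ∀ n : ℤ, -l ≤ n → deltaD G n ⌊x * (2:ℝ) ^ n⌋ x = 0 := fun n hn =>
      hG.deltaD_eq_zero (m := -l - 1) (by omega)
        (dyadicI_subset_of_mem (by omega) ((mem_dyadicI_iff _ _ _).2 rfl) hxm) x
    apply Summable.of_nat_of_neg
    · refine summable_of_hasFiniteSupport ((Set.finite_Iio (-l).toNat).subset fun n hn => ?_)
      by_contra hlt
      simp only [Set.mem_Iio, not_lt] at hlt
      have h := hzero n (by omega)
      exact hn (by simpa using h)
    · refine Summable.of_nonneg_of_le (fun n => sq_nonneg _) (fun n => ?_)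
        ((summable_geometric_of_lt_one (r := (1/4:ℝ)) (by norm_num) (by norm_num)).mul_left 9)
      have h := hG.abs_deltaD_le (-(n:ℤ)) ⌊x * (2:ℝ) ^ (-(n:ℤ))⌋ x
      have h2 := pow_le_pow_left₀ (abs_nonneg _) h 2
      rw [sq_abs] at h2
      refine h2.trans_eq ?_
      rw [mul_pow, zpow_neg, zpow_natCast, inv_pow, ← pow_mul, mul_comm n 2, pow_mul, one_div,
        inv_pow]
      norm_num
  · rintro ⟨n, k⟩ hq
    have : x ∉ dyadicI n k := fun h => hq ⟨n, by simp [(mem_dyadicI_iff n k x).1 h]⟩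
    simp [deltaD_eq_zero_of_notMem G this]

namespace IsAlternatingSign

variable {G : ℝ → ℝ}

theorem avgD_zero_rec (hG : IsAlternatingSign G) {m : ℤ} (hm : 0 ≤ m) :
    avgD G m 0 = (avgD G (m+1) 0 + (-1) ^ m) / 2 := by
  have h2 : (0:ℝ) < 2 ^ (-(m+1)) := by positivity
  have hm2 : (2:ℝ) ^ (-m) = 2 * 2 ^ (-(m+1)) := by
    rw [neg_add, zpow_add₀ two_ne_zero]; norm_num; ring
  have hsplit : ∫ x in Set.Ico (0:ℝ) (2 ^ (-m)), G x =
      (∫ x in Set.Ico (0:ℝ) (2 ^ (-(m+1))), G x) + 2 ^ (-(m+1)) * (-1) ^ m := by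
    have hle : (2:ℝ) ^ (-(m+1)) ≤ 2 ^ (-m) := by linarith
    rw [← Set.Ico_union_Ico_eq_Ico h2.le hle,
      setIntegral_union Set.Ico_disjoint_Ico_same measurableSet_Ico
        hG.integrable.integrableOn hG.integrable.integrableOn,
      hG.setIntegral_eq hm hle le_rfl le_rfl, hm2]
    ring
  simp only [avgD, avgI, Int.cast_zero, zero_mul, zero_add, one_mul, sub_zero, hsplit]
  rw [hm2]
  field_simp

theorem quarter_le_sq_deltaD (hG : IsAlternatingSign G) {m : ℤ} (hm : 0 ≤ m) {x : ℝ}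
    (hx : x ∈ dyadicI (m+1) 0) : 1 / 4 ≤ (deltaD G m 0 x) ^ 2 := by
  have hx0 : x ∈ dyadicI m 0 := by simpa using dyadicI_left_child_subset m 0 (by simpa using hx)
  have hx1 : x ∉ dyadicI (m+1) (2 * 0 + 1) := by
    rw [mem_dyadicI_iff] at hx ⊢
    omega
  have hd : deltaD G m 0 x = avgD G (m+1) 0 - avgD G m 0 := by
    simp only [deltaD, mul_zero, Set.indicator_of_mem hx, Set.indicator_of_mem hx0]
    rw [Set.indicator_of_notMem (by simpa using hx1)]
    ring
  have r0 := hG.avgD_zero_rec hm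
  have r1 := hG.avgD_zero_rec (m := m+1) (by omega)
  have h2 := abs_le.1 (hG.abs_avgD_le_one (m+1+1) 0)
  rw [zpow_add₀ (by norm_num), zpow_one] at r1
  rcases Int.even_or_odd m with hev | hod
  · rw [hev.neg_one_zpow] at r0 r1
    rw [hd]
    nlinarith
  · rw [hod.neg_one_zpow] at r0 r1
    rw [hd]
    nlinarith

theorem sqrt_le_sqFn (hG : IsAlternatingSign G) {N : ℕ} {x : ℝ}
    (hx : x ∈ Set.Ioo (0:ℝ) ((2:ℝ) ^ (-(N:ℤ)))) : Real.sqrt (N / 4) ≤ sqFn G x := by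
  have hx1 : x ∈ Set.Ioo (0:ℝ) 1 :=
    ⟨hx.1, hx.2.trans_le (zpow_le_one_of_nonpos₀ one_le_two (by omega))⟩
  have hmem : ∀ m : ℕ, m < N → x ∈ dyadicI ((m:ℤ) + 1) 0 := fun m hm =>
    ⟨by simpa using hx.1.le, hx.2.trans_le (by
      simpa using zpow_le_zpow_right₀ (one_le_two (α := ℝ))
        (show -(N:ℤ) ≤ -((m:ℤ) + 1) by omega))⟩
  have hinj : Function.Injective fun m : ℕ => ((m:ℤ), (0:ℤ)) :=
    fun a b h => by simpa using h
  apply Real.sqrt_le_sqrt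
  calc (N:ℝ) / 4 = ∑ m ∈ Finset.range N, (1/4:ℝ) := by simp [div_eq_mul_inv]
    _ ≤ ∑ m ∈ Finset.range N, (deltaD G m 0 x) ^ 2 := Finset.sum_le_sum fun m hm =>
        hG.quarter_le_sq_deltaD (by omega) (hmem m (Finset.mem_range.1 hm))
    _ = ∑ q ∈ (Finset.range N).map ⟨_, hinj⟩, (deltaD G q.1 q.2 x) ^ 2 := by simp
    _ ≤ _ := (hG.summable_sq_deltaD hx1).sum_le_tsum _ fun _ _ => sq_nonneg _

theorem le_pNorm_sqFn (hG : IsAlternatingSign G) {p β : ℝ} (hp : 0 < p)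
    (hβ : β ∈ Set.Ioo (0:ℝ) 1) :
    ENNReal.ofReal (((1/2) ^ p / 4) ^ (1/p) * (1 - β) ^ (-(1/2 : ℝ) - 1/p)) ≤
      pNorm p (sqFn G) (fun x => if x = 0 then 1 else |x| ^ (-β)) := by
  have hs : 0 < 1 - β := sub_pos.2 hβ.2
  set N := ⌈1 / (1 - β)⌉₊
  have hN1 : 1 / (1 - β) ≤ N := Nat.le_ceil _
  have hN2 : (N:ℝ) < 1 / (1 - β) + 1 := Nat.ceil_lt_add_one (by positivity)
  set r : ℝ := (2:ℝ) ^ (-(N:ℤ)) with hr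
  have hr0 : 0 < r := by positivity
  have hint : ∫⁻ x in Set.Ioo (0:ℝ) r, ENNReal.ofReal (x ^ (-β)) =
      ENNReal.ofReal (r ^ (1 - β) / (1 - β)) := by
    have hii : IntegrableOn (fun x : ℝ => x ^ (-β)) (Set.Ioo 0 r) :=
      (intervalIntegral.integrableOn_Ioo_rpow_iff hr0).2 (by linarith [hβ.2])
    rw [← ofReal_integral_eq_lintegral_ofReal hii
      ((ae_restrict_mem measurableSet_Ioo).mono fun x hx => Real.rpow_nonneg hx.1.le _),
      ← integral_Ioc_eq_integral_Ioo, ← intervalIntegral.integral_of_le hr0.le,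
      integral_rpow (Or.inl (by linarith [hβ.2])), neg_add_eq_sub,
      Real.zero_rpow hs.ne', sub_zero]
  have hlower : ENNReal.ofReal (Real.sqrt (N / 4) ^ p * (r ^ (1 - β) / (1 - β))) ≤
      ∫⁻ x : ℝ, ENNReal.ofReal (|sqFn G x| ^ p * (if x = 0 then 1 else |x| ^ (-β))) := by
    rw [ENNReal.ofReal_mul (by positivity), ← hint,
      ← lintegral_const_mul' _ _ ENNReal.ofReal_ne_top]
    refine le_trans (setLIntegral_mono' measurableSet_Ioo fun x hx => ?_)
      (setLIntegral_le_lintegral (Set.Ioo 0 r) _)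
    rw [← ENNReal.ofReal_mul (by positivity), if_neg hx.1.ne', abs_of_pos hx.1]
    have hle := hG.sqrt_le_sqFn hx
    have hx0 : 0 ≤ x ^ (-β) := Real.rpow_nonneg hx.1.le _
    gcongr
    exact hle.trans (le_abs_self _)
  have hr4 : 1 / 4 ≤ r ^ (1 - β) := by
    rw [hr, ← Real.rpow_intCast, ← Real.rpow_mul zero_le_two,
      show (1/4:ℝ) = 2 ^ (-2:ℝ) by rw [Real.rpow_neg zero_le_two]; norm_num]
    apply Real.rpow_le_rpow_of_exponent_le one_le_two
    have : (N:ℝ) * (1 - β) ≤ (1 / (1 - β) + 1) * (1 - β) := by gcongr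
    rw [add_mul, div_mul_cancel₀ _ hs.ne'] at this
    push_cast
    linarith [hβ.1]
  have hsqrt : (1/2) ^ p * (1 - β) ^ (-(p/2)) ≤ Real.sqrt (N / 4) ^ p := by
    have h1 : (1/2) * (1 - β) ^ (-(1/2:ℝ)) ≤ Real.sqrt (N / 4) := by
      apply Real.le_sqrt_of_sq_le
      rw [mul_pow, ← Real.rpow_natCast, ← Real.rpow_natCast, ← Real.rpow_mul hs.le]
      norm_num [Real.rpow_neg_one]
      rw [one_div] at hN1
      linarith
    calc _ = ((1/2) * (1 - β) ^ (-(1/2:ℝ))) ^ p := by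
          rw [Real.mul_rpow (by norm_num) (by positivity), ← Real.rpow_mul hs.le]
          ring_nf
      _ ≤ _ := by gcongr
  rw [pNorm]
  refine le_trans (le_of_eq ?_) (ENNReal.rpow_le_rpow
    ((ENNReal.ofReal_le_ofReal (mul_le_mul hsqrt
      (div_le_div_of_nonneg_right hr4 hs.le) (by positivity) (by positivity))).trans hlower)
    (by positivity))
  rw [ENNReal.ofReal_rpow_of_nonneg (by positivity) (by positivity)]
  congr 1
  rw [show (1/2:ℝ) ^ p * (1 - β) ^ (-(p/2)) * (1 / 4 / (1 - β)) =
      ((1/2) ^ p / 4) * ((1 - β) ^ (-(p/2) - 1)) by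
    rw [Real.rpow_sub_one hs.ne']; ring,
    Real.mul_rpow (by positivity) (by positivity), ← Real.rpow_mul hs.le]
  congr 2
  field_simp

end IsAlternatingSign

/-- The product `σ f` is the alternating sign function. -/
theorem isAlternatingSign_mul (a : ℝ) :
    IsAlternatingSign (fun x : ℝ =>
      (if x = 0 then 1 else |x| ^ a) *
        (if x = 0 then 1
          else if x ∈ Set.Ioo (0:ℝ) 1 then (-1:ℝ) ^ ⌊-Real.logb 2 x⌋ * |x| ^ (-a) else 0)) := by
  have hval : ∀ x ∈ Set.Ioo (0:ℝ) 1, (if x = 0 then 1 else |x| ^ a) *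
      (if x = 0 then 1
        else if x ∈ Set.Ioo (0:ℝ) 1 then (-1:ℝ) ^ ⌊-Real.logb 2 x⌋ * |x| ^ (-a) else 0) =
      (-1:ℝ) ^ ⌊-Real.logb 2 x⌋ := by
    intro x hx
    have h : 0 < |x| ^ a := Real.rpow_pos_of_pos (abs_pos.2 hx.1.ne') _
    rw [if_neg hx.1.ne', if_neg hx.1.ne', if_pos hx, Real.rpow_neg (abs_nonneg x)]
    field_simp
  refine ⟨?_, fun x => ?_, fun m hm x hx => ?_⟩
  · have hsign : Measurable fun x : ℝ => (-1:ℝ) ^ ⌊-Real.logb 2 x⌋ :=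
      (measurable_of_countable fun k : ℤ => (-1:ℝ) ^ k).comp
        (Int.measurable_floor.comp (Real.measurable_log.div_const _).neg)
    have habs : Measurable fun x : ℝ => |x| := measurable_id.abs
    exact (Measurable.ite (measurableSet_singleton 0) measurable_const (habs.pow_const a)).mul
      (Measurable.ite (measurableSet_singleton 0) measurable_const
        (Measurable.ite measurableSet_Ioo (hsign.mul (habs.pow_const (-a))) measurable_const))
  · by_cases h0 : x = 0
    · simp [h0]
    by_cases hx : x ∈ Set.Ioo (0:ℝ) 1
    · rw [hval x hx, abs_zpow, Set.indicator_of_mem (Set.Ioo_subset_Ico_self hx)]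
      simp
    · simp only [if_neg h0, if_neg hx, mul_zero, abs_zero]
      exact Set.indicator_nonneg (fun _ _ => zero_le_one) x
  · have hx0 : 0 < x := lt_trans (by positivity) hx.1
    rw [hval x ⟨hx0, hx.2.trans_le (zpow_le_one_of_nonpos₀ one_le_two (by omega))⟩]
    congr 1
    have h1 : ((-(m+1) : ℤ) : ℝ) < Real.logb 2 x := by
      rw [Real.lt_logb_iff_rpow_lt one_lt_two hx0, Real.rpow_intCast]
      exact hx.1
    have h2 : Real.logb 2 x < ((-m : ℤ) : ℝ) := by
      rw [Real.logb_lt_iff_lt_rpow one_lt_two hx0, Real.rpow_intCast]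
      exact hx.2
    push_cast at h1 h2
    rw [Int.floor_eq_iff]
    constructor <;> linarith

/-- For `p ∈ (2,∞)`, `β ∈ (0,1)`,
`f(x) = (-1)^{⌊-log₂ x⌋} |x|^{-β/(p-1)} 1_{(0,1)}(x)`, `σ(x) = |x|^{β/(p-1)}`,
`w(x) = |x|^{-β}` (with `f(0) = σ(0) = w(0) = 1`), one has
`‖S(σf)‖_{L^p(w)} ≥ c_p (1-β)^{-1/2-1/p}` with `c_p > 0` depending only on `p`,
`S` being the dyadic square function on `ℝ`. -/
theorem statement8 (p : ℝ) (hp : 2 < p) :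
    ∃ c > (0:ℝ), ∀ β ∈ Set.Ioo (0:ℝ) 1,
      ENNReal.ofReal (c * (1 - β) ^ (-(1/2 : ℝ) - 1/p)) ≤
        pNorm p
          (sqFn (fun x =>
            (if x = 0 then 1 else |x| ^ (β / (p - 1))) *
              (if x = 0 then 1
                else if x ∈ Set.Ioo (0:ℝ) 1 then
                  (-1:ℝ) ^ ⌊-Real.logb 2 x⌋ * |x| ^ (-(β / (p - 1)))
                else 0)))
          (fun x => if x = 0 then 1 else |x| ^ (-β)) := by
  exact ⟨((1/2) ^ p / 4) ^ (1/p), by positivity, fun β hβ =>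
    (isAlternatingSign_mul (β / (p - 1))).le_pNorm_sqFn (by linarith) hβ⟩

end
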